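/- arXiv:2503.19652 — 2 statements merged into one kernel-verified Lean document; each statement's English description precedes it below -/
import Mathlib

section
/- Let (X,d) be a proper, geodesic metric space and f : X → ℝ an L-Lipschitz convex function. Then inf_{x∈X} |∇⁻f|(x) > 0 if and only if there exists a ray ξ : [0,∞) → X with f∘ξ convex and lim_{t→∞} f(ξ(t))/t < 0. Moreover, in this case inf_{x∈X} |∇⁻f|(x) = sup_ξ ( −lim_{t→∞} f(ξ(t))/t ), the supremum over all rays ξ with f∘ξ convex (strong duality). -/
open Set Filter

/-- The descending slope `|∇⁻f|(x) = limsup_{y→x} max{f(x)−f(y),0} / d(x,y)`. -/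
noncomputable def descSlope {X : Type*} [MetricSpace X] (f : X → ℝ) (x : X) : ℝ :=
  Filter.limsup (fun y => max (f x - f y) 0 / dist x y) (nhdsWithin x {x}ᶜ)

open Topology

section Slope

variable {X : Type*} [MetricSpace X] {f : X → ℝ}

/-- A positive lower bound on the descending slope yields points of proportional descent. -/
theorem exists_lt_of_lt_descSlope {x : X} {c : ℝ} (hc : 0 ≤ c) (h : c < descSlope f x) :
    ∃ y, y ≠ x ∧ c * dist x y < f x - f y := by
  unfold descSlope at h
  rcases (𝓝[≠] x).eq_or_neBot with hb | hb
  · rw [hb] at h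
    simp [limsup, limsSup] at h
    linarith
  · have hco : IsCoboundedUnder (· ≤ ·) (𝓝[≠] x) fun y => max (f x - f y) 0 / dist x y :=
      IsBoundedUnder.isCoboundedUnder_le
        (isBoundedUnder_of ⟨0, fun y => div_nonneg (le_max_right _ _) dist_nonneg⟩)
    obtain ⟨y, hy, hyx⟩ :=
      ((frequently_lt_of_lt_limsup hco h).and_eventually self_mem_nhdsWithin).exists
    have hd : 0 < dist x y := dist_pos.2 (Ne.symm hyx)
    rw [lt_div_iff₀ hd] at hy
    refine ⟨y, hyx, (lt_max_iff.1 hy).resolve_right (not_lt.2 (by positivity))⟩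

/-- Along an interpolating geodesic, the descending slope dominates the difference quotient. -/
theorem max_sub_le_descSlope_mul_dist {L : ℝ} (hf : ∀ x y : X, |f x - f y| ≤ L * dist x y)
    (hL : 0 ≤ L)
    (hconv : ∀ x y : X, ∃ γ : ℝ → X, γ 0 = x ∧ γ 1 = y ∧
      (∀ s ∈ Icc (0:ℝ) 1, ∀ t ∈ Icc (0:ℝ) 1, dist (γ s) (γ t) = |s - t| * dist x y) ∧
      ∀ s ∈ Icc (0:ℝ) 1, f (γ s) ≤ (1 - s) * f x + s * f y) (x y : X) :
    max (f x - f y) 0 ≤ descSlope f x * dist x y := by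
  rcases eq_or_ne x y with rfl | hxy
  · simp
  have hd : 0 < dist x y := dist_pos.2 hxy
  obtain ⟨γ, h0, h1, hγ, hfγ⟩ := hconv x y
  have hγ0 : ∀ s ∈ Icc (0:ℝ) 1, dist x (γ s) = s * dist x y := fun s hs => by
    rw [← h0, hγ 0 (by simp) s hs, h0, zero_sub, abs_neg, abs_of_nonneg hs.1]
  have hev : ∀ᶠ s : ℝ in 𝓝[>] 0, s ∈ Ioc (0:ℝ) 1 := Ioc_mem_nhdsGT one_pos
  have htend : Tendsto γ (𝓝[>] 0) (𝓝[≠] x) := by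
    refine tendsto_nhdsWithin_iff.2 ⟨?_, ?_⟩
    · rw [tendsto_iff_dist_tendsto_zero]
      have : Tendsto (fun s : ℝ => s * dist x y) (𝓝[>] 0) (𝓝 0) := by
        have := ((continuous_id.mul continuous_const).tendsto' (0:ℝ) (0 * dist x y) rfl :
          Tendsto (fun s : ℝ => s * dist x y) _ _)
        rw [zero_mul] at this
        exact this.mono_left nhdsWithin_le_nhds
      refine this.congr' ?_
      filter_upwards [hev] with s hs
      rw [dist_comm (γ s), hγ0 s ⟨hs.1.le, hs.2⟩]
    · filter_upwards [hev] with s hs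
      have : 0 < dist x (γ s) := by
        rw [hγ0 s ⟨hs.1.le, hs.2⟩]
        exact mul_pos hs.1 hd
      exact (dist_pos.1 this).symm
  rw [← div_le_iff₀ hd]
  refine le_limsup_of_frequently_le (htend.frequently (Eventually.frequently ?_)) ?_
  · filter_upwards [hev] with s hs
    have hs' : s ∈ Icc (0:ℝ) 1 := ⟨hs.1.le, hs.2⟩
    rw [hγ0 s hs', div_le_div_iff₀ hd (mul_pos hs.1 hd)]
    have h2 : s * max (f x - f y) 0 ≤ max (f x - f (γ s)) 0 := by
      rw [mul_max_of_nonneg _ _ hs'.1, mul_zero]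
      exact max_le_max (by linarith [hfγ s hs']) le_rfl
    nlinarith
  · refine isBoundedUnder_of ⟨L, fun z => ?_⟩
    refine div_le_of_le_mul₀ dist_nonneg hL (max_le ((le_abs_self _).trans (hf x z)) ?_)
    positivity

/-- Weak duality. -/
theorem neg_le_descSlope_of_ray {L : ℝ} (hf : ∀ x y : X, |f x - f y| ≤ L * dist x y)
    (hL : 0 ≤ L)
    (hconv : ∀ x y : X, ∃ γ : ℝ → X, γ 0 = x ∧ γ 1 = y ∧
      (∀ s ∈ Icc (0:ℝ) 1, ∀ t ∈ Icc (0:ℝ) 1, dist (γ s) (γ t) = |s - t| * dist x y) ∧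
      ∀ s ∈ Icc (0:ℝ) 1, f (γ s) ≤ (1 - s) * f x + s * f y)
    {ξ : ℝ → X} {a : ℝ}
    (hξ : ∀ s ∈ Ici (0:ℝ), ∀ t ∈ Ici (0:ℝ), dist (ξ s) (ξ t) = |s - t|)
    (ha : Tendsto (fun t => f (ξ t) / t) atTop (𝓝 a)) (x : X) : -a ≤ descSlope f x := by
  have key := max_sub_le_descSlope_mul_dist hf hL hconv x
  have hS : 0 ≤ descSlope f x := by
    have : ∃ y, y ≠ x := by
      by_contra! h
      have := hξ 0 (by simp) 1 (by simp)
      rw [h (ξ 0), h (ξ 1)] at this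
      simp at this
    obtain ⟨y, hy⟩ := this
    have h1 : 0 ≤ descSlope f x * dist x y := (le_max_right _ _).trans (key y)
    exact nonneg_of_mul_nonneg_left h1 (dist_pos.2 hy.symm)
  have hl : Tendsto (fun t : ℝ => f x / t - f (ξ t) / t) atTop (𝓝 (0 - a)) :=
    (tendsto_const_nhds.div_atTop tendsto_id).sub ha
  have hr : Tendsto (fun t : ℝ => descSlope f x * (dist x (ξ 0) / t + 1)) atTop
      (𝓝 (descSlope f x * (0 + 1))) :=
    ((tendsto_const_nhds.div_atTop tendsto_id).add tendsto_const_nhds).const_mul _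
  have := le_of_tendsto_of_tendsto hl hr (by
    filter_upwards [eventually_gt_atTop 0] with t ht
    have h1 : f x - f (ξ t) ≤ descSlope f x * dist x (ξ t) := (le_max_left _ _).trans (key _)
    have h2 : dist x (ξ t) ≤ dist x (ξ 0) + t := by
      have := dist_triangle x (ξ 0) (ξ t)
      rwa [hξ 0 (by simp) t ht.le, zero_sub, abs_neg, abs_of_pos ht] at this
    have h3 := h1.trans (mul_le_mul_of_nonneg_left h2 hS)
    rw [← sub_div, div_add_one ht.ne', mul_div_assoc']
    exact (div_le_div_iff_of_pos_right ht).2 h3)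
  linarith

end Slope

section Chains

variable {X : Type*} [MetricSpace X]

/-- The distances along a chain of short steps of minimal total length are the expected ones. -/
theorem dist_eq_of_chain {N : ℕ} {h : ℝ} {p : ℕ → X}
    (hstep : ∀ i < N, dist (p i) (p (i + 1)) ≤ h) (htot : dist (p 0) (p N) = N * h)
    {i j : ℕ} (hij : i ≤ j) (hj : j ≤ N) : dist (p i) (p j) = (j - i) * h := by
  have le : ∀ i j, i ≤ j → j ≤ N → dist (p i) (p j) ≤ (j - i) * h := by
    intro i j hij
    induction j, hij using Nat.le_induction with
    | base => intro _; simp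
    | succ j hij ih =>
      intro hj
      have := dist_triangle (p i) (p j) (p (j + 1))
      have h1 := ih (by omega)
      have h2 := hstep j (by omega)
      push_cast
      linarith
  have h0 := le 0 i (by omega) (by omega)
  have h1 := le i j hij hj
  have h2 := le j N hj le_rfl
  have h3 := dist_triangle4 (p 0) (p i) (p j) (p N)
  push_cast at h0
  linarith

/-- Midpoint convexity of a finite sequence implies the three-point inequality. -/
theorem three_point_of_midpoint {N : ℕ} {u : ℕ → ℝ}
    (hu : ∀ i, i + 2 ≤ N → 2 * u (i + 1) ≤ u i + u (i + 2)) {i j k : ℕ} (hij : i ≤ j) (hjk : j ≤ k)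
    (hk : k ≤ N) : ((k:ℝ) - i) * u j ≤ (k - j) * u i + (j - i) * u k := by
  have step : ∀ m n, m ≤ n → n + 1 ≤ N → u (m + 1) - u m ≤ u (n + 1) - u n := by
    intro m n hmn
    induction n, hmn using Nat.le_induction with
    | base => intro _; exact le_rfl
    | succ n hmn ih => intro hn; linarith [ih (by omega), hu n hn]
  have left : ∀ m, i ≤ m → m + 1 ≤ N → ((m:ℝ) - i) * (u (m + 1) - u m) ≥ u m - u i := by
    intro m him
    induction m, him using Nat.le_induction with
    | base => intro _; simp
    | succ m him ih =>
      intro hm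
      have h1 := ih (by omega)
      have h2 := hu m hm
      have h3 : (i:ℝ) ≤ m := by exact_mod_cast him
      push_cast
      nlinarith
  induction k, hjk using Nat.le_induction with
  | base => linarith
  | succ k hjk ih =>
    have h1 := ih (by omega)
    have h2 := left k (by omega) hk
    have h3 : (i:ℝ) ≤ j := by exact_mod_cast hij
    have h4 : (j:ℝ) ≤ k := by exact_mod_cast hjk
    push_cast
    rcases (h3.trans h4).eq_or_lt with h5 | h5
    · have h6 : (j:ℝ) = i := by linarith
      have h7 : j = i := by exact_mod_cast h6
      subst h7
      linarith
    · have h6 : ((k:ℝ) - i) * (((k:ℝ) + 1 - i) * u j) ≤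
          ((k:ℝ) - i) * ((k + 1 - j) * u i + (j - i) * u (k + 1)) := by
        have e1 := mul_le_mul_of_nonneg_left h1 (by linarith : (0:ℝ) ≤ (k:ℝ) + 1 - i)
        have e2 := mul_le_mul_of_nonneg_left h2 (by linarith : (0:ℝ) ≤ (j:ℝ) - i)
        nlinarith
      exact le_of_mul_le_mul_left h6 (by linarith)

variable [ProperSpace X] {f : X → ℝ}

/-- Any two points are joined by an equidistant chain of prescribed size along which `f` is
convex: it is obtained by minimising the sum of the values of `f`. -/
theorem exists_convex_chain (hcont : Continuous f)
    (hconv : ∀ x y : X, ∃ γ : ℝ → X, γ 0 = x ∧ γ 1 = y ∧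
      (∀ s ∈ Icc (0:ℝ) 1, ∀ t ∈ Icc (0:ℝ) 1, dist (γ s) (γ t) = |s - t| * dist x y) ∧
      ∀ s ∈ Icc (0:ℝ) 1, f (γ s) ≤ (1 - s) * f x + s * f y)
    (x y : X) {N : ℕ} (hN : 0 < N) :
    ∃ p : ℕ → X, p 0 = x ∧ p N = y ∧ (∀ i < N, dist (p i) (p (i + 1)) ≤ dist x y / N) ∧
      ∀ i, i + 2 ≤ N → 2 * f (p (i + 1)) ≤ f (p i) + f (p (i + 2)) := by
  set h := dist x y / N with hh
  have hN' : (0:ℝ) < N := by exact_mod_cast hN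
  let K : Set (ℕ → X) := (univ.pi fun _ => Metric.closedBall x (dist x y)) ∩
    {p | p 0 = x ∧ p N = y ∧ ∀ i < N, dist (p i) (p (i + 1)) ≤ h}
  have hK : IsCompact K := by
    refine (isCompact_univ_pi fun _ => isCompact_closedBall _ _).inter_right ?_
    have hc : IsClosed {p : ℕ → X | ∀ i < N, dist (p i) (p (i + 1)) ≤ h} := by
      simp only [ofPred_forall]
      refine isClosed_iInter fun i => isClosed_iInter fun _ => ?_
      exact isClosed_le (by fun_prop) continuous_const
    exact (isClosed_eq (continuous_apply 0) continuous_const).inter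
      ((isClosed_eq (continuous_apply N) continuous_const).inter hc)
  have hne : K.Nonempty := by
    obtain ⟨γ, h0, h1, hγ, -⟩ := hconv x y
    have hmem : ∀ i : ℕ, min ((i:ℝ) / N) 1 ∈ Icc (0:ℝ) 1 := fun i =>
      ⟨le_min (by positivity) zero_le_one, min_le_right _ _⟩
    refine ⟨fun i => γ (min (i / N) 1), ?_, ?_, ?_, ?_⟩
    · intro i _
      rw [Metric.mem_closedBall, dist_comm]
      nth_rewrite 1 [← h0]
      rw [hγ 0 (by simp) _ (hmem i), zero_sub, abs_neg, abs_of_nonneg (hmem i).1]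
      exact mul_le_of_le_one_left dist_nonneg (hmem i).2
    · simp [h0]
    · simp [div_self hN'.ne', h1]
    · intro i hi
      have hi' : ((i:ℝ) + 1) ≤ N := by exact_mod_cast hi
      rw [hγ _ (hmem _) _ (hmem _), min_eq_left ((div_le_one hN').2 (by linarith)),
        min_eq_left ((div_le_one hN').2 (by push_cast; linarith)), ← sub_div]
      push_cast
      rw [sub_add_cancel_left, abs_div, abs_neg, abs_one, abs_of_pos hN', hh]
      exact le_of_eq (by ring)
  obtain ⟨p, hpK, hmin⟩ := hK.exists_isMinOn hne
    (f := fun p => ∑ i ∈ Finset.range N, f (p i)) (by fun_prop)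
  obtain ⟨hpball, hp0, hpN, hstep⟩ := hpK
  refine ⟨p, hp0, hpN, hstep, fun i hi => ?_⟩
  have htot : dist (p 0) (p N) = N * h := by rw [hp0, hpN, hh]; field_simp
  have hd : dist (p i) (p (i + 2)) = 2 * h := by
    rw [dist_eq_of_chain hstep htot (by omega : i ≤ i + 2) hi]
    push_cast
    ring
  obtain ⟨γ, h0, h1, hγ, hfγ⟩ := hconv (p i) (p (i + 2))
  have hm : (1/2:ℝ) ∈ Icc (0:ℝ) 1 := by constructor <;> norm_num
  have hm0 : dist (p i) (γ (1/2)) = h := by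
    have := hγ 0 (by simp) _ hm
    rw [h0, hd, zero_sub, abs_neg, abs_of_pos (by norm_num)] at this
    linarith
  have hm1 : dist (γ (1/2)) (p (i + 2)) = h := by
    have := hγ _ hm 1 (by simp)
    rw [h1, hd] at this
    norm_num [abs_of_pos] at this ⊢
    linarith
  have hfm := hfγ _ hm
  set m := γ (1/2)
  let q := Function.update p (i + 1) m
  have hq : ∀ j, j ≠ i + 1 → q j = p j := fun j hj => Function.update_of_ne hj _ _
  have hqi : q (i + 1) = m := Function.update_self _ _ _
  have hq0 : q 0 = x := by rw [hq 0 (by omega), hp0]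
  have hqN : q N = y := by rw [hq N (by omega), hpN]
  have hqstep : ∀ j < N, dist (q j) (q (j + 1)) ≤ h := by
    intro j hj
    rcases eq_or_ne j i with rfl | hji
    · rw [hqi, hq j (by omega), hm0]
    rcases eq_or_ne j (i + 1) with rfl | hji'
    · rw [hqi, hq _ (by omega)]
      exact hm1.le
    · rw [hq j hji', hq _ (by omega)]
      exact hstep j hj
  have hh0 : 0 ≤ h := by positivity
  have hqK : q ∈ K := by
    refine ⟨fun j _ => ?_, hq0, hqN, hqstep⟩
    rcases eq_or_ne j (i + 1) with rfl | hj
    · have := dist_eq_of_chain hqstep (by rw [hq0, hqN, hh]; field_simp) (Nat.zero_le (i + 1))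
        (by omega)
      rw [Metric.mem_closedBall, dist_comm]
      nth_rewrite 1 [← hq0]
      have hiN : ((i + 1 : ℕ) : ℝ) ≤ N := by exact_mod_cast (by omega : i + 1 ≤ N)
      rw [this, Nat.cast_zero, sub_zero]
      calc _ ≤ N * h := mul_le_mul_of_nonneg_right hiN hh0
        _ = dist x y := by rw [hh]; field_simp
    · rw [hq j hj]
      exact hpball j trivial
  have hle : ∑ j ∈ Finset.range N, f (p j) ≤ ∑ j ∈ Finset.range N, f (q j) := hmin hqK
  have hi1 : i + 1 ∈ Finset.range N := Finset.mem_range.2 (by omega)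
  rw [← Finset.add_sum_erase _ _ hi1, ← Finset.add_sum_erase _ (fun j => f (q j)) hi1, hqi,
    Finset.sum_congr rfl fun j hj => congrArg f (hq j (Finset.ne_of_mem_erase hj))] at hle
  linarith

end Chains

section Rays

variable {X : Type*} [MetricSpace X] [ProperSpace X] {f : X → ℝ}

/-- If every point admits a point of descent at rate `c`, then from any point one can descend at
rate `c` arbitrarily far. -/
theorem exists_far_descent {c : ℝ} (hcont : Continuous f)
    (hdesc : ∀ x : X, ∃ y, y ≠ x ∧ c * dist x y < f x - f y) (hc : 0 < c) (x : X) (R : ℝ) :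
    ∃ y, R ≤ dist x y ∧ f y ≤ f x - c * dist x y := by
  by_contra! hR
  let K : Set X := {y | f y ≤ f x - c * dist x y}
  have hK : IsCompact K := by
    refine (isCompact_closedBall x R).of_isClosed_subset
      (isClosed_le hcont (by fun_prop)) fun y hy => ?_
    rw [Metric.mem_closedBall, dist_comm]
    by_contra! h
    exact absurd hy (not_le.2 (hR y h.le))
  obtain ⟨y, hy, hmin⟩ := hK.exists_isMinOn ⟨x, by simp [K]⟩ hcont.continuousOn
  obtain ⟨z, hzy, hz⟩ := hdesc y
  have hy' : f y ≤ f x - c * dist x y := hy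
  have hzK : z ∈ K := by
    have := mul_le_mul_of_nonneg_left (dist_triangle x y z) hc.le
    change f z ≤ f x - c * dist x z
    linarith
  have h1 : f y ≤ f z := hmin hzK
  have h2 : 0 < c * dist y z := mul_pos hc (dist_pos.2 hzy.symm)
  linarith

/-- A coarse ray: a map `q` with a reparametrisation `τ` close to the identity, satisfying all
the required properties on `[0, n]` with respect to `τ`. -/
theorem exists_coarse_ray {c : ℝ} (hcont : Continuous f)
    (hconv : ∀ x y : X, ∃ γ : ℝ → X, γ 0 = x ∧ γ 1 = y ∧
      (∀ s ∈ Icc (0:ℝ) 1, ∀ t ∈ Icc (0:ℝ) 1, dist (γ s) (γ t) = |s - t| * dist x y) ∧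
      ∀ s ∈ Icc (0:ℝ) 1, f (γ s) ≤ (1 - s) * f x + s * f y)
    {x y : X} {n : ℕ} (hn : (n:ℝ) + 1 ≤ dist x y) (hy : f y ≤ f x - c * dist x y) :
    ∃ (q : ℝ → X) (τ : ℝ → ℝ), (∀ t : ℝ, 0 ≤ t → |τ t - t| ≤ 1 / ((n:ℝ) + 1)) ∧
      (∀ s : ℝ, 0 ≤ s → s ≤ n → ∀ t : ℝ, 0 ≤ t → t ≤ n → dist (q s) (q t) = |τ s - τ t|) ∧
      (∀ t : ℝ, 0 ≤ t → t ≤ n → dist x (q t) = τ t) ∧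
      (∀ r s t : ℝ, 0 ≤ r → r ≤ s → s ≤ t → t ≤ n →
        (τ t - τ r) * f (q s) ≤ (τ t - τ s) * f (q r) + (τ s - τ r) * f (q t)) ∧
      ∀ t : ℝ, 0 ≤ t → t ≤ n → f (q t) ≤ f x - c * τ t := by
  have hn0 : (0:ℝ) < (n:ℝ) + 1 := by positivity
  have hD : 0 < dist x y := hn0.trans_le hn
  set N : ℕ := ⌈dist x y⌉₊ * (n + 1) with hNdef
  have hN : 0 < N := Nat.mul_pos (Nat.ceil_pos.2 hD) n.succ_pos
  have hN' : (0:ℝ) < N := by exact_mod_cast hN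
  obtain ⟨p, hp0, hpN, hstep, hmid⟩ := exists_convex_chain hcont hconv x y hN
  set h := dist x y / N with hh
  have hpos : 0 < h := div_pos hD hN'
  have hNh : N * h = dist x y := by rw [hh]; field_simp
  have hsmall : h ≤ 1 / ((n:ℝ) + 1) := by
    rw [hh, div_le_div_iff₀ hN' hn0, one_mul, hNdef]
    push_cast
    exact mul_le_mul_of_nonneg_right (Nat.le_ceil _) hn0.le
  have htot : dist (p 0) (p N) = N * h := by rw [hp0, hpN, hNh]
  have hk : ∀ t : ℝ, t ≤ n → ⌊t / h⌋₊ ≤ N := fun t ht => by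
    refine Nat.floor_le_of_le ((div_le_iff₀ hpos).2 ?_)
    rw [hNh]
    linarith
  have hmono : ∀ s t : ℝ, s ≤ t → ⌊s / h⌋₊ ≤ ⌊t / h⌋₊ := fun s t hst =>
    Nat.floor_le_floor (div_le_div_of_nonneg_right hst hpos.le)
  have hdist : ∀ s t : ℝ, s ≤ t → t ≤ n →
      dist (p ⌊s / h⌋₊) (p ⌊t / h⌋₊) = |⌊s / h⌋₊ * h - ⌊t / h⌋₊ * h| := fun s t hst ht => by
    have h1 : (⌊s / h⌋₊ : ℝ) ≤ ⌊t / h⌋₊ := by exact_mod_cast hmono s t hst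
    rw [dist_eq_of_chain hstep htot (hmono s t hst) (hk t ht), ← sub_mul, abs_mul,
      abs_of_pos hpos, abs_sub_comm, abs_of_nonneg (sub_nonneg.2 h1)]
  refine ⟨fun t => p ⌊t / h⌋₊, fun t => ⌊t / h⌋₊ * h, fun t ht => ?_, fun s _ hs t _ ht => ?_,
    fun t _ ht => ?_, fun r s t _ hrs hst ht => ?_, fun t _ ht => ?_⟩
  · have h1 := Nat.floor_le (div_nonneg ht hpos.le)
    have h2 := Nat.lt_floor_add_one (t / h)
    rw [le_div_iff₀ hpos] at h1
    rw [div_lt_iff₀ hpos] at h2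
    rw [abs_le]
    constructor <;> linarith
  · rcases le_total s t with hst | hst
    · exact hdist s t hst ht
    · rw [dist_comm, abs_sub_comm]
      exact hdist t s hst hs
  · have := dist_eq_of_chain hstep htot (Nat.zero_le _) (hk t ht)
    rw [hp0] at this
    simpa using this
  · have := three_point_of_midpoint (u := fun i => f (p i)) hmid (hmono r s hrs) (hmono s t hst)
      (hk t ht)
    have := mul_le_mul_of_nonneg_left this hpos.le
    dsimp only at this ⊢
    linarith
  · have := three_point_of_midpoint (u := fun i => f (p i)) hmid (Nat.zero_le _) (hk t ht) le_rfl
    have hkN : (⌊t / h⌋₊ : ℝ) ≤ N := by exact_mod_cast hk t ht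
    simp only [hp0, hpN, Nat.cast_zero, sub_zero] at this
    refine le_of_mul_le_mul_left (this.trans ?_) hN'
    have h1 := mul_le_mul_of_nonneg_left hy (Nat.cast_nonneg (α := ℝ) ⌊t / h⌋₊)
    rw [← hNh] at h1
    linarith

/-- Strong duality, existence part: descent at rate `c` everywhere produces a ray along which `f`
is convex and descends at rate `c`. -/
theorem exists_ray_of_descent {c : ℝ} (hcont : Continuous f)
    (hconv : ∀ x y : X, ∃ γ : ℝ → X, γ 0 = x ∧ γ 1 = y ∧
      (∀ s ∈ Icc (0:ℝ) 1, ∀ t ∈ Icc (0:ℝ) 1, dist (γ s) (γ t) = |s - t| * dist x y) ∧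
      ∀ s ∈ Icc (0:ℝ) 1, f (γ s) ≤ (1 - s) * f x + s * f y)
    (hdesc : ∀ x : X, ∃ y, y ≠ x ∧ c * dist x y < f x - f y) (hc : 0 < c) (x : X) :
    ∃ ξ : ℝ → X, (∀ s ∈ Ici (0:ℝ), ∀ t ∈ Ici (0:ℝ), dist (ξ s) (ξ t) = |s - t|) ∧
      ConvexOn ℝ (Ici (0:ℝ)) (fun t => f (ξ t)) ∧ ∀ t, 0 ≤ t → f (ξ t) ≤ f x - c * t := by
  choose y hyd hyf using fun n : ℕ => exists_far_descent hcont hdesc hc x ((n:ℝ) + 1)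
  choose q τ hτ hdist hdist0 hthree hdown using
    fun n : ℕ => exists_coarse_ray hcont hconv (hyd n) (hyf n)
  let U : Ultrafilter ℕ := hyperfilter ℕ
  have hU : (U : Filter ℕ) ≤ atTop := Nat.hyperfilter_le_atTop
  have hlarge : ∀ t : ℝ, ∀ᶠ n : ℕ in U, t ≤ n := fun t =>
    hU (tendsto_natCast_atTop_atTop.eventually_ge_atTop t)
  have hτlim : ∀ t, 0 ≤ t → Tendsto (fun n => τ n t) U (𝓝 t) := fun t ht => by
    rw [tendsto_iff_dist_tendsto_zero]
    exact squeeze_zero (fun _ => dist_nonneg) (fun n => hτ n t ht)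
      (tendsto_one_div_add_atTop_nhds_zero_nat.mono_left hU)
  have hex : ∀ t : ℝ, ∃ z, 0 ≤ t → Tendsto (fun n => q n t) U (𝓝 z) := by
    intro t
    by_cases ht : 0 ≤ t
    · obtain ⟨z, -, hz⟩ := (isCompact_closedBall x (t + 1)).ultrafilter_le_nhds
        (U.map fun n => q n t) (by
          rw [le_principal_iff]
          change ∀ᶠ n in U, q n t ∈ Metric.closedBall x (t + 1)
          filter_upwards [hlarge t,
            (hτlim t ht).eventually (eventually_le_nhds (lt_add_one t))] with n hn hn'
          rw [Metric.mem_closedBall, dist_comm, hdist0 n t ht hn]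
          exact hn')
      exact ⟨z, fun _ => hz⟩
    · exact ⟨x, fun h => absurd h ht⟩
  choose ξ hξ using hex
  have hfξ : ∀ t, 0 ≤ t → Tendsto (fun n => f (q n t)) U (𝓝 (f (ξ t))) := fun t ht =>
    (hcont.tendsto _).comp (hξ t ht)
  refine ⟨ξ, fun s hs t ht => ?_, ⟨convex_Ici 0, ?_⟩, fun t ht => ?_⟩
  · refine tendsto_nhds_unique ((hξ s hs).dist (hξ t ht)) ?_
    refine (((hτlim s hs).sub (hτlim t ht)).abs).congr' ?_
    filter_upwards [hlarge s, hlarge t] with n hns hnt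
    exact (hdist n s hs hns t ht hnt).symm
  · have h3 : ∀ r s t, 0 ≤ r → r ≤ s → s ≤ t →
        (t - r) * f (ξ s) ≤ (t - s) * f (ξ r) + (s - r) * f (ξ t) := by
      intro r s t hr hrs hst
      have hs := hr.trans hrs
      have ht := hs.trans hst
      refine le_of_tendsto_of_tendsto
        (((hτlim t ht).sub (hτlim r hr)).mul (hfξ s hs))
        ((((hτlim t ht).sub (hτlim s hs)).mul (hfξ r hr)).add
          (((hτlim s hs).sub (hτlim r hr)).mul (hfξ t ht))) ?_
      filter_upwards [hlarge t] with n hn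
      exact hthree n r s t hr hrs hst hn
    have h4 : ∀ r t, 0 ≤ r → r < t → ∀ a b : ℝ, 0 ≤ a → 0 ≤ b → a + b = 1 →
        f (ξ (a * r + b * t)) ≤ a * f (ξ r) + b * f (ξ t) := by
      intro r t hr hrt a b ha hb hab
      obtain rfl : a = 1 - b := by linarith
      have := h3 r ((1 - b) * r + b * t) t hr (by nlinarith) (by nlinarith)
      refine le_of_mul_le_mul_left (this.trans (le_of_eq ?_)) (sub_pos.2 hrt)
      ring
    intro r hr t ht a b ha hb hab
    simp only [smul_eq_mul]
    rcases lt_trichotomy r t with h | rfl | h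
    · exact h4 r t hr h a b ha hb hab
    · rw [← add_mul, ← add_mul, hab, one_mul, one_mul]
    · rw [add_comm (a * r), add_comm (a * _)]
      exact h4 t r ht h b a hb ha (by linarith)
  · refine le_of_tendsto_of_tendsto (hfξ t ht)
      (tendsto_const_nhds.sub ((hτlim t ht).const_mul c)) ?_
    filter_upwards [hlarge t] with n hn
    exact hdown n t ht hn

end Rays

/-- A convex function on `[0, ∞)` of at most linear growth has an asymptotic slope. -/
theorem ConvexOn.exists_tendsto_div_atTop {g : ℝ → ℝ} (hg : ConvexOn ℝ (Ici (0:ℝ)) g) {L : ℝ}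
    (hL : ∀ t, 0 ≤ t → g t - g 0 ≤ L * t) :
    ∃ a, Tendsto (fun t => g t / t) atTop (𝓝 a) := by
  let G : ℝ → ℝ := fun t => (g (max t 1) - g 0) / max t 1
  have hpos : ∀ t : ℝ, 0 < max t 1 := fun t => lt_max_of_lt_right one_pos
  have hmono : Monotone G := fun s t hst => by
    have h := max_le_max_right 1 hst
    simpa [G] using hg.secant_mono (a := 0) (by simp) (hpos s).le (hpos t).le (hpos s).ne'
      (hpos t).ne' h
  have hbdd : BddAbove (range G) := by
    refine ⟨L, ?_⟩
    rintro _ ⟨t, rfl⟩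
    exact (div_le_iff₀ (hpos t)).2 (hL _ (hpos t).le)
  refine ⟨(⨆ t, G t) + 0, ((tendsto_atTop_ciSup hmono hbdd).add
    ((tendsto_const_nhds (x := g 0)).div_atTop tendsto_id)).congr' ?_⟩
  filter_upwards [eventually_ge_atTop 1] with t ht
  simp only [G, max_eq_left ht, id]
  rw [← add_div, sub_add_cancel]

/-- Strong duality: for an `L`-Lipschitz convex function `f` on a proper geodesic metric
space, `inf_x |∇⁻f|(x) > 0` iff there is a ray along which `f` is convex with negative
asymptotic slope; and in this case `inf_x |∇⁻f|(x)` equals the supremum of `−a` over all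
asymptotic slopes `a` of rays along which `f` is convex. -/
theorem strong_duality
    {X : Type*} [MetricSpace X] [ProperSpace X] [Nonempty X]
    (hgeo : ∀ x y : X, ∃ γ : ℝ → X, γ 0 = x ∧ γ 1 = y ∧
      ∀ s ∈ Icc (0:ℝ) 1, ∀ t ∈ Icc (0:ℝ) 1, dist (γ s) (γ t) = |s - t| * dist x y)
    (L : ℝ) (hL : 0 < L) (f : X → ℝ)
    (hf : ∀ x y : X, |f x - f y| ≤ L * dist x y)
    (hconv : ∀ x y : X, ∃ γ : ℝ → X, γ 0 = x ∧ γ 1 = y ∧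
      (∀ s ∈ Icc (0:ℝ) 1, ∀ t ∈ Icc (0:ℝ) 1, dist (γ s) (γ t) = |s - t| * dist x y) ∧
      ∀ s ∈ Icc (0:ℝ) 1, f (γ s) ≤ (1 - s) * f x + s * f y) :
    ((0 < ⨅ x : X, descSlope f x) ↔
      (∃ (ξ : ℝ → X) (a : ℝ),
        (∀ s ∈ Ici (0:ℝ), ∀ t ∈ Ici (0:ℝ), dist (ξ s) (ξ t) = |s - t|) ∧
        ConvexOn ℝ (Ici (0:ℝ)) (fun t => f (ξ t)) ∧
        Tendsto (fun t => f (ξ t) / t) atTop (nhds a) ∧ a < 0)) ∧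
    ((∃ (ξ : ℝ → X) (a : ℝ),
        (∀ s ∈ Ici (0:ℝ), ∀ t ∈ Ici (0:ℝ), dist (ξ s) (ξ t) = |s - t|) ∧
        ConvexOn ℝ (Ici (0:ℝ)) (fun t => f (ξ t)) ∧
        Tendsto (fun t => f (ξ t) / t) atTop (nhds a) ∧ a < 0) →
      (⨅ x : X, descSlope f x) =
        sSup {b : ℝ | ∃ (ξ : ℝ → X) (a : ℝ),
          (∀ s ∈ Ici (0:ℝ), ∀ t ∈ Ici (0:ℝ), dist (ξ s) (ξ t) = |s - t|) ∧
          ConvexOn ℝ (Ici (0:ℝ)) (fun t => f (ξ t)) ∧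
          Tendsto (fun t => f (ξ t) / t) atTop (nhds a) ∧ b = -a}) := by
  have hcont : Continuous f := by
    refine (LipschitzWith.of_dist_le_mul (K := L.toNNReal) fun x y => ?_).continuous
    rw [Real.dist_eq, Real.coe_toNNReal _ hL.le]
    exact hf x y
  have hstrong : ∀ c, 0 < c → (c < ⨅ x : X, descSlope f x) → ∃ (ξ : ℝ → X) (a : ℝ),
      (∀ s ∈ Ici (0:ℝ), ∀ t ∈ Ici (0:ℝ), dist (ξ s) (ξ t) = |s - t|) ∧
      ConvexOn ℝ (Ici (0:ℝ)) (fun t => f (ξ t)) ∧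
      Tendsto (fun t => f (ξ t) / t) atTop (nhds a) ∧ a ≤ -c := by
    intro c hc hlt
    have hbdd : BddBelow (range fun x : X => descSlope f x) := by
      by_contra h
      rw [Real.iInf_of_not_bddBelow h] at hlt
      exact hlt.not_gt hc
    obtain ⟨x⟩ := ‹Nonempty X›
    obtain ⟨ξ, hξ, hcx, hdown⟩ := exists_ray_of_descent hcont hconv
      (fun x => exists_lt_of_lt_descSlope hc.le (hlt.trans_le (ciInf_le hbdd x))) hc x
    obtain ⟨a, ha⟩ := hcx.exists_tendsto_div_atTop (L := L) fun t ht => by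
      have := (le_abs_self _).trans (hf (ξ t) (ξ 0))
      rwa [hξ t ht 0 (by simp), sub_zero, abs_of_nonneg ht] at this
    refine ⟨ξ, a, hξ, hcx, ha, ?_⟩
    have hr : Tendsto (fun t : ℝ => f x / t - c) atTop (𝓝 (0 - c)) :=
      (tendsto_const_nhds.div_atTop tendsto_id).sub_const c
    rw [zero_sub] at hr
    refine le_of_tendsto_of_tendsto ha hr ?_
    filter_upwards [eventually_gt_atTop 0] with t ht
    rw [div_sub' ht.ne', mul_comm t c]
    exact (div_le_div_iff_of_pos_right ht).2 (hdown t ht.le)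
  have hweak : ∀ (ξ : ℝ → X) (a : ℝ),
      (∀ s ∈ Ici (0:ℝ), ∀ t ∈ Ici (0:ℝ), dist (ξ s) (ξ t) = |s - t|) →
      Tendsto (fun t => f (ξ t) / t) atTop (nhds a) → -a ≤ ⨅ x : X, descSlope f x :=
    fun ξ a hξ ha => le_ciInf (neg_le_descSlope_of_ray hf hL.le hconv hξ ha)
  have hpos : (∃ (ξ : ℝ → X) (a : ℝ),
        (∀ s ∈ Ici (0:ℝ), ∀ t ∈ Ici (0:ℝ), dist (ξ s) (ξ t) = |s - t|) ∧
        ConvexOn ℝ (Ici (0:ℝ)) (fun t => f (ξ t)) ∧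
        Tendsto (fun t => f (ξ t) / t) atTop (nhds a) ∧ a < 0) →
      0 < ⨅ x : X, descSlope f x := by
    rintro ⟨ξ, a, hξ, -, ha, ha0⟩
    exact (neg_pos.2 ha0).trans_le (hweak ξ a hξ ha)
  refine ⟨⟨fun h => ?_, hpos⟩, fun hray => le_antisymm ?_ ?_⟩
  · obtain ⟨ξ, a, hξ, hcx, ha, hac⟩ := hstrong _ (half_pos h) (half_lt_self h)
    exact ⟨ξ, a, hξ, hcx, ha, by linarith⟩
  · refine le_of_forall_lt_imp_le_of_dense fun c hc => ?_
    obtain ⟨c', hc', hlt⟩ := exists_between (max_lt hc (hpos hray))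
    obtain ⟨ξ, a, hξ, hcx, ha, hac⟩ := hstrong c' ((le_max_right _ _).trans_lt hc') hlt
    refine ((le_max_left c 0).trans (hc'.le.trans (le_neg_of_le_neg hac))).trans
      (le_csSup ⟨⨅ x : X, descSlope f x, ?_⟩ ⟨ξ, a, hξ, hcx, ha, rfl⟩)
    rintro _ ⟨ξ, a, hξ, -, ha, rfl⟩
    exact hweak ξ a hξ ha
  · obtain ⟨ξ, a, hξ, hcx, ha, -⟩ := hray
    refine csSup_le ⟨-a, ξ, a, hξ, hcx, ha, rfl⟩ ?_
    rintro _ ⟨ξ, a, hξ, -, ha, rfl⟩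
    exact hweak ξ a hξ ha
end

section
/- Let (X,d) be a proper, geodesic δ-hyperbolic metric space and f : X → ℝ an L-Lipschitz convex function. Assume α > 0, where −α is the infimum of lim_{t→∞} f(ξ(t))/t over all rays ξ in X with f∘ξ convex, and let ζ : [0,∞) → X be a ray with f∘ζ convex and lim_{t→∞} f(ζ(t))/t < 0 (the unique direction of negative asymptotic slope). Fix τ > 0, x₀ ∈ X, and a sequence with x_k ∈ J^f_τ(x_{k−1}) for each k ∈ ℕ. Then x_k converges to the boundary point of ζ, i.e., for every M > 0 there exist K ∈ ℕ and T > 0 such that (x_k | ζ(t))_{x₀} ≥ M for all k ≥ K and t ≥ T. -/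
open Set Filter

/-- The Gromov product `(x|y)_p = (d(p,x)+d(p,y)-d(x,y))/2`. -/
noncomputable def gromovProduct {X : Type*} [MetricSpace X] (p x y : X) : ℝ :=
  (dist p x + dist p y - dist x y) / 2

/-- A point of a geodesic `γ` from `y` to `z` lies within `(y|z)_p + 2δ` of `p`. -/
theorem exists_dist_le_gromovProduct_add {X : Type*} [MetricSpace X] {δ : ℝ}
    (hhyp : ∀ p x y z : X,
      gromovProduct p x z ≥ min (gromovProduct p x y) (gromovProduct p y z) - δ)
    (p y z : X) {γ : ℝ → X} (h0 : γ 0 = y) (h1 : γ 1 = z)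
    (hγ : ∀ s ∈ Icc (0:ℝ) 1, ∀ t ∈ Icc (0:ℝ) 1, dist (γ s) (γ t) = |s - t| * dist y z) :
    ∃ s ∈ Icc (0:ℝ) 1, dist p (γ s) ≤ gromovProduct p y z + 2 * δ := by
  obtain ⟨s, hs, hsu⟩ : ∃ s ∈ Icc (0:ℝ) 1, s * dist y z = dist p y - gromovProduct p y z := by
    have hu0 : 0 ≤ dist p y - gromovProduct p y z := by
      have := dist_triangle p y z
      unfold gromovProduct
      linarith
    have hu1 : dist p y - gromovProduct p y z ≤ dist y z := by
      have := dist_triangle y z p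
      rw [dist_comm y p, dist_comm z p] at this
      unfold gromovProduct
      linarith
    rcases (dist_nonneg (x := y) (y := z)).eq_or_lt with h | h
    · exact ⟨0, ⟨le_rfl, zero_le_one⟩, by linarith⟩
    · exact ⟨(dist p y - gromovProduct p y z) / dist y z,
        ⟨div_nonneg hu0 h.le, (div_le_one h).2 hu1⟩, div_mul_cancel₀ _ h.ne'⟩
  refine ⟨s, hs, ?_⟩
  have hy : dist y (γ s) = s * dist y z := by
    have := hγ 0 ⟨le_rfl, zero_le_one⟩ s hs
    rwa [h0, zero_sub, abs_neg, abs_of_nonneg hs.1] at this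
  have hz : dist (γ s) z = (1 - s) * dist y z := by
    have := hγ s hs 1 ⟨zero_le_one, le_rfl⟩
    rwa [h1, abs_sub_comm, abs_of_nonneg (sub_nonneg.2 hs.2)] at this
  have h := hhyp p y (γ s) z
  have e1 : gromovProduct p y (γ s) = (dist p (γ s) + gromovProduct p y z) / 2 := by
    rw [gromovProduct, hy, hsu]
    ring
  have e2 : gromovProduct p (γ s) z = (dist p (γ s) + gromovProduct p y z) / 2 := by
    have hg : gromovProduct p y z = (dist p y + dist p z - dist y z) / 2 := rfl
    rw [gromovProduct, hz]
    linarith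
  rw [e1, e2, min_self] at h
  linarith

/-- The Gromov product of two points of a sublevel set of a convex Lipschitz function is
bounded below in terms of the level. -/
theorem sub_le_mul_gromovProduct_add {X : Type*} [MetricSpace X] {δ : ℝ}
    (hhyp : ∀ p x y z : X,
      gromovProduct p x z ≥ min (gromovProduct p x y) (gromovProduct p y z) - δ)
    {L : ℝ} (hL : 0 < L) {f : X → ℝ}
    (hf : ∀ x y : X, |f x - f y| ≤ L * dist x y)
    (hconv : ∀ x y : X, ∃ γ : ℝ → X, γ 0 = x ∧ γ 1 = y ∧
      (∀ s ∈ Icc (0:ℝ) 1, ∀ t ∈ Icc (0:ℝ) 1, dist (γ s) (γ t) = |s - t| * dist x y) ∧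
      ∀ s ∈ Icc (0:ℝ) 1, f (γ s) ≤ (1 - s) * f x + s * f y)
    (p : X) {y z : X} {c : ℝ} (hy : f y ≤ c) (hz : f z ≤ c) :
    f p - c ≤ L * (gromovProduct p y z + 2 * δ) := by
  obtain ⟨γ, h0, h1, hγ, hγf⟩ := hconv y z
  obtain ⟨s, hs, hd⟩ := exists_dist_le_gromovProduct_add hhyp p y z h0 h1 hγ
  have hfs : f (γ s) ≤ c := by
    have a1 := mul_le_mul_of_nonneg_left hy (sub_nonneg.2 hs.2)
    have a2 := mul_le_mul_of_nonneg_left hz hs.1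
    linarith [hγf s hs]
  have := (le_abs_self _).trans (hf p (γ s))
  have := mul_le_mul_of_nonneg_left hd hL.le
  linarith

/-- Slope estimate for a proximal point `y` of `x`: the decrease of a convex function towards
any other point `z` is controlled by the length of the proximal step. -/
theorem mul_sub_le_dist_mul_dist_of_prox {X : Type*} [MetricSpace X] {f : X → ℝ}
    (hconv : ∀ x y : X, ∃ γ : ℝ → X, γ 0 = x ∧ γ 1 = y ∧
      (∀ s ∈ Icc (0:ℝ) 1, ∀ t ∈ Icc (0:ℝ) 1, dist (γ s) (γ t) = |s - t| * dist x y) ∧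
      ∀ s ∈ Icc (0:ℝ) 1, f (γ s) ≤ (1 - s) * f x + s * f y)
    {τ : ℝ} (hτ : 0 < τ) {x y : X}
    (hprox : ∀ z : X, f y + dist x y ^ 2 / (2 * τ) ≤ f z + dist x z ^ 2 / (2 * τ)) (z : X) :
    τ * (f y - f z) ≤ dist x y * dist y z := by
  obtain ⟨γ, h0, h1, hγ, hγf⟩ := hconv y z
  have key : ∀ s ∈ Ioc (0:ℝ) 1,
      2 * (τ * (f y - f z)) ≤ 2 * (dist x y * dist y z) + s * dist y z ^ 2 := by
    intro s hs
    have hs' : s ∈ Icc (0:ℝ) 1 := ⟨hs.1.le, hs.2⟩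
    have hd : dist y (γ s) = s * dist y z := by
      have := hγ 0 ⟨le_rfl, zero_le_one⟩ s hs'
      rwa [h0, zero_sub, abs_neg, abs_of_nonneg hs'.1] at this
    have hx : dist x (γ s) ≤ dist x y + s * dist y z := hd ▸ dist_triangle x y (γ s)
    have hsq := pow_le_pow_left₀ dist_nonneg hx 2
    have h := hprox (γ s)
    have hfs := hγf s hs'
    have h' : dist x y ^ 2 / (2 * τ) ≤
        s * (f z - f y) + (dist x y + s * dist y z) ^ 2 / (2 * τ) := by
      have : dist x (γ s) ^ 2 / (2 * τ) ≤ (dist x y + s * dist y z) ^ 2 / (2 * τ) := by gcongr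
      linarith
    have hm := mul_le_mul_of_nonneg_right h' (by positivity : 0 ≤ 2 * τ)
    rw [add_mul, div_mul_cancel₀ _ (by positivity), div_mul_cancel₀ _ (by positivity)] at hm
    refine le_of_mul_le_mul_left ?_ hs.1
    linarith
  by_contra! hlt
  set e := τ * (f y - f z) - dist x y * dist y z with he
  have hepos : 0 < e := by linarith
  have hpos : 0 < dist y z ^ 2 + 1 := by positivity
  have hm := key (min 1 (e / (dist y z ^ 2 + 1))) ⟨by positivity, min_le_left _ _⟩
  have : min 1 (e / (dist y z ^ 2 + 1)) * dist y z ^ 2 ≤ e := by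
    calc _ ≤ e / (dist y z ^ 2 + 1) * (dist y z ^ 2 + 1) := by
          gcongr
          · exact min_le_right _ _
          · linarith
      _ = e := div_mul_cancel₀ _ hpos.ne'
  linarith

/-- A convex function which is unbounded below is unbounded below along proximal sequences. -/
theorem exists_lt_of_prox {X : Type*} [MetricSpace X] {f : X → ℝ}
    (hconv : ∀ x y : X, ∃ γ : ℝ → X, γ 0 = x ∧ γ 1 = y ∧
      (∀ s ∈ Icc (0:ℝ) 1, ∀ t ∈ Icc (0:ℝ) 1, dist (γ s) (γ t) = |s - t| * dist x y) ∧
      ∀ s ∈ Icc (0:ℝ) 1, f (γ s) ≤ (1 - s) * f x + s * f y)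
    {τ : ℝ} (hτ : 0 < τ) {x : ℕ → X}
    (hprox : ∀ k : ℕ, ∀ z : X,
      f (x (k + 1)) + dist (x k) (x (k + 1)) ^ 2 / (2 * τ) ≤
        f z + dist (x k) z ^ 2 / (2 * τ))
    (hunb : ∀ c : ℝ, ∃ y, f y ≤ c) (m : ℝ) : ∃ k, f (x k) < m := by
  by_contra! hm
  obtain ⟨y, hy⟩ := hunb (m - 1)
  set S := 2 * τ * (f (x 0) - m) with hS
  set R := dist (x 0) y with hR
  have hS0 : 0 ≤ S := mul_nonneg (by positivity) (sub_nonneg.2 (hm 0))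
  have hsum : ∀ n, ∑ k ∈ Finset.range n, dist (x k) (x (k + 1)) ^ 2 ≤ S := by
    intro n
    have : ∑ k ∈ Finset.range n, dist (x k) (x (k + 1)) ^ 2 ≤ 2 * τ * (f (x 0) - f (x n)) := by
      rw [← Finset.sum_range_sub' (fun k => f (x k)), Finset.mul_sum]
      refine Finset.sum_le_sum fun k _ => ?_
      have h := hprox k (x k)
      rw [dist_self, zero_pow two_ne_zero, zero_div, add_zero] at h
      have : dist (x k) (x (k + 1)) ^ 2 / (2 * τ) ≤ f (x k) - f (x (k + 1)) := by linarith
      rwa [div_le_iff₀' (by positivity)] at this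
    refine this.trans ?_
    rw [hS]
    have := hm n
    gcongr
  have hdist : ∀ n : ℕ, dist (x 0) (x n) ^ 2 ≤ n * S := by
    intro n
    calc dist (x 0) (x n) ^ 2
        ≤ (∑ k ∈ Finset.range n, dist (x k) (x (k + 1))) ^ 2 := by
          gcongr
          exact dist_le_range_sum_dist x n
      _ ≤ n * ∑ k ∈ Finset.range n, dist (x k) (x (k + 1)) ^ 2 := by
          simpa using sq_sum_le_card_mul_sum_sq (s := Finset.range n)
            (f := fun k => dist (x k) (x (k + 1)))
      _ ≤ n * S := by
          gcongr
          exact hsum n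
  set C := 2 * S + 2 * R ^ 2 + 1 with hC
  have hC0 : 0 < C := by positivity
  have hstep : ∀ k : ℕ, τ ^ 2 / C * (1 / ((k : ℝ) + 1)) ≤ dist (x k) (x (k + 1)) ^ 2 := by
    intro k
    have hk : (0:ℝ) ≤ k := k.cast_nonneg
    have h := mul_sub_le_dist_mul_dist_of_prox hconv hτ (hprox k) y
    have hτl : τ ≤ dist (x k) (x (k + 1)) * dist (x (k + 1)) y := by
      refine le_trans ?_ h
      have : 1 ≤ f (x (k + 1)) - f y := by linarith [hm (k + 1)]
      nlinarith
    have hl : dist (x (k + 1)) y ^ 2 ≤ C * (k + 1) := by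
      have h1 : dist (x (k + 1)) y ≤ dist (x 0) (x (k + 1)) + R := by
        rw [dist_comm (x 0)]
        exact dist_triangle _ _ _
      have h2 := pow_le_pow_left₀ dist_nonneg h1 2
      have h3 := hdist (k + 1)
      push_cast at h3
      nlinarith [sq_nonneg (dist (x 0) (x (k + 1)) - R), mul_nonneg hk (sq_nonneg R)]
    rw [div_mul_div_comm, mul_one, div_le_iff₀ (by positivity)]
    calc τ ^ 2 ≤ (dist (x k) (x (k + 1)) * dist (x (k + 1)) y) ^ 2 := by gcongr
      _ = dist (x k) (x (k + 1)) ^ 2 * dist (x (k + 1)) y ^ 2 := mul_pow _ _ _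
      _ ≤ _ := by gcongr
  have htop := Real.tendsto_sum_range_one_div_nat_succ_atTop.const_mul_atTop
    (by positivity : 0 < τ ^ 2 / C)
  obtain ⟨n, hn⟩ := (htop.eventually_gt_atTop S).exists
  rw [Finset.mul_sum] at hn
  exact absurd (hn.trans_le (Finset.sum_le_sum fun k _ => hstep k)) (hsum n).not_gt

/-- Divergence of the discrete-time gradient flow to the unique direction of negative
asymptotic slope: if `−α < 0` is the infimum of the asymptotic slopes of `f` over all rays
along which `f` is convex, `ζ` is a ray with `f ∘ ζ` convex and negative asymptotic slope,
and `(x_k)` is a proximal sequence with step size `τ`, then the Gromov products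
`(x_k | ζ(t))_{x₀}` tend to infinity as `k, t → ∞`. -/
theorem proximal_sequence_diverges_to_boundary
    {X : Type*} [MetricSpace X] [ProperSpace X] (δ : ℝ) (hδ : 0 ≤ δ)
    (hgeo : ∀ x y : X, ∃ γ : ℝ → X, γ 0 = x ∧ γ 1 = y ∧
      ∀ s ∈ Icc (0:ℝ) 1, ∀ t ∈ Icc (0:ℝ) 1, dist (γ s) (γ t) = |s - t| * dist x y)
    (hhyp : ∀ p x y z : X,
      gromovProduct p x z ≥ min (gromovProduct p x y) (gromovProduct p y z) - δ)
    (L : ℝ) (hL : 0 < L) (f : X → ℝ)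
    (hf : ∀ x y : X, |f x - f y| ≤ L * dist x y)
    (hconv : ∀ x y : X, ∃ γ : ℝ → X, γ 0 = x ∧ γ 1 = y ∧
      (∀ s ∈ Icc (0:ℝ) 1, ∀ t ∈ Icc (0:ℝ) 1, dist (γ s) (γ t) = |s - t| * dist x y) ∧
      ∀ s ∈ Icc (0:ℝ) 1, f (γ s) ≤ (1 - s) * f x + s * f y)
    (α : ℝ) (hα : 0 < α)
    (hglb : IsGLB {a : ℝ | ∃ ξ : ℝ → X,
      (∀ s ∈ Ici (0:ℝ), ∀ t ∈ Ici (0:ℝ), dist (ξ s) (ξ t) = |s - t|) ∧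
      ConvexOn ℝ (Ici (0:ℝ)) (fun t => f (ξ t)) ∧
      Tendsto (fun t => f (ξ t) / t) atTop (nhds a)} (-α))
    (ζ : ℝ → X)
    (hζ : ∀ s ∈ Ici (0:ℝ), ∀ t ∈ Ici (0:ℝ), dist (ζ s) (ζ t) = |s - t|)
    (hζconv : ConvexOn ℝ (Ici (0:ℝ)) (fun t => f (ζ t)))
    (hζslope : ∃ b : ℝ, Tendsto (fun t => f (ζ t) / t) atTop (nhds b) ∧ b < 0)
    (τ : ℝ) (hτ : 0 < τ) (x : ℕ → X)
    (hprox : ∀ k : ℕ, ∀ z : X,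
      f (x (k + 1)) + dist (x k) (x (k + 1)) ^ 2 / (2 * τ) ≤
        f z + dist (x k) z ^ 2 / (2 * τ)) :
    ∀ M > (0:ℝ), ∃ (K : ℕ) (T : ℝ), 0 < T ∧
      ∀ k ≥ K, ∀ t ≥ T, M ≤ gromovProduct (x 0) (x k) (ζ t) := by
  intro M _
  obtain ⟨b, hb, hb0⟩ := hζslope
  have hbot : Tendsto (fun t => f (ζ t)) atTop atBot := by
    refine (hb.neg_mul_atTop hb0 tendsto_id).congr' ?_
    filter_upwards [eventually_gt_atTop 0] with t ht
    exact div_mul_cancel₀ _ ht.ne'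
  set c := f (x 0) - L * (M + 2 * δ) with hc
  obtain ⟨K, hK⟩ := exists_lt_of_prox hconv hτ hprox
    (fun c => (hbot.eventually_le_atBot c).exists.imp' ζ fun _ h => h) c
  obtain ⟨T, hT⟩ := eventually_atTop.1 (hbot.eventually_le_atBot c)
  have hanti : Antitone fun k => f (x k) := antitone_nat_of_succ_le fun k => by
    have h := hprox k (x k)
    rw [dist_self, zero_pow two_ne_zero, zero_div, add_zero] at h
    have : 0 ≤ dist (x k) (x (k + 1)) ^ 2 / (2 * τ) := by positivity
    linarith
  refine ⟨K, max T 1, by positivity, fun k hk t ht => ?_⟩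
  have h := sub_le_mul_gromovProduct_add hhyp hL hf hconv (x 0)
    ((hanti hk).trans hK.le) (hT t ((le_max_left _ _).trans ht))
  rw [hc, sub_sub_cancel] at h
  linarith [le_of_mul_le_mul_left h hL]
end
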